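/- arXiv:2505.07130 — 2 statements merged into one kernel-verified Lean document; each statement's English description precedes it below -/
import Mathlib

section
/- Let m ≥ 3 be an integer. Then there exists a binary linear code (q = 2) with parameters [3·2^{2m−3} − 1, 2m−1, 2^{2m−3}]_2 and maximum weight 2^{2m−2} that is a minimal code violating the Ashikhmin-Barg condition. Moreover, when m ≥ 4, such a code can be taken to be self-orthogonal. -/
open Finset BigOperators

/-- Ceiling division on naturals: `cdiv a b = ⌈a / b⌉`. -/
def cdiv (a b : ℕ) : ℕ := (a + b - 1) / b

/-- The minimum Hamming weight of a nonzero codeword of a linear code. -/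
noncomputable def wmin {F : Type} [Field F] [Fintype F] [DecidableEq F] {n : ℕ}
    (C : Submodule F (Fin n → F)) : ℕ :=
  sInf {w | ∃ c ∈ C, c ≠ (0 : Fin n → F) ∧ hammingNorm c = w}

/-- The maximum Hamming weight of a codeword of a linear code. -/
noncomputable def wmax {F : Type} [Field F] [Fintype F] [DecidableEq F] {n : ℕ}
    (C : Submodule F (Fin n → F)) : ℕ :=
  sSup {w | ∃ c ∈ C, hammingNorm c = w}

/-- A linear code is minimal if every nonzero codeword `c` is minimal: any codeword `c'`
whose support is contained in the support of `c` is a scalar multiple of `c`. -/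
def IsMinimalCode {F : Type} [Field F] [Fintype F] [DecidableEq F] {n : ℕ}
    (C : Submodule F (Fin n → F)) : Prop :=
  ∀ c ∈ C, c ≠ (0 : Fin n → F) → ∀ c' ∈ C,
    {i : Fin n | c' i ≠ 0} ⊆ {i : Fin n | c i ≠ 0} → ∃ l : F, c' = l • c

/-- A linear code is self-orthogonal if the standard inner product of any two codewords is 0. -/
def SelfOrthogonal {F : Type} [Field F] {n : ℕ} (C : Submodule F (Fin n → F)) : Prop :=
  ∀ c ∈ C, ∀ c' ∈ C, ∑ i, c i * c' i = 0

/-- A linear `[n,k]_q` code is projective if it is the image of `x ↦ (x·g_1, …, x·g_n)` for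
nonzero, pairwise linearly independent vectors `g_1, …, g_n ∈ F_q^k`. -/
def IsProjectiveCode {F : Type} [Field F] {n : ℕ} (k : ℕ) (C : Submodule F (Fin n → F)) : Prop :=
  ∃ g : Fin n → (Fin k → F),
    (∀ i, g i ≠ 0) ∧
    (∀ i j, i ≠ j → ∀ l : F, g i ≠ l • g j) ∧
    (C : Set (Fin n → F)) = {c | ∃ x : Fin k → F, c = fun i => ∑ t, x t * g i t}

/-- `Aw C w` is the number of codewords of `C` of Hamming weight `w`. -/
noncomputable def Aw {F : Type} [Field F] [Fintype F] [DecidableEq F] {n : ℕ}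
    (C : Submodule F (Fin n → F)) (w : ℕ) : ℕ :=
  Set.ncard {c : Fin n → F | c ∈ C ∧ hammingNorm c = w}

section BinaryWeights

variable {ι : Type*} [Fintype ι]

theorem hammingNorm_add_add_two_mul_card_inter (c c' : ι → ZMod 2) :
    hammingNorm (c + c') + 2 * #{i | c i ≠ 0 ∧ c' i ≠ 0} = hammingNorm c + hammingNorm c' := by
  have key : ∀ a b : ZMod 2, (if a + b ≠ 0 then 1 else 0) + 2 * (if a ≠ 0 ∧ b ≠ 0 then 1 else 0)
      = (if a ≠ 0 then 1 else 0) + (if b ≠ 0 then 1 else 0 : ℕ) := by decide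
  simp only [hammingNorm, card_filter, mul_sum, ← sum_add_distrib]
  exact sum_congr rfl fun i _ => key _ _

theorem sum_mul_eq_card_inter (c c' : ι → ZMod 2) :
    ∑ i, c i * c' i = (#{i | c i ≠ 0 ∧ c' i ≠ 0} : ℕ) := by
  have key : ∀ a b : ZMod 2, a * b = if a ≠ 0 ∧ b ≠ 0 then 1 else 0 := by decide
  rw [card_filter, Nat.cast_sum]
  exact sum_congr rfl fun i _ => by rw [key]; split_ifs <;> simp

theorem hammingNorm_add_of_support_subset {c c' : ι → ZMod 2}
    (h : {i | c' i ≠ 0} ⊆ {i | c i ≠ 0}) :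
    hammingNorm (c + c') + hammingNorm c' = hammingNorm c := by
  have h1 := hammingNorm_add_add_two_mul_card_inter c c'
  have h2 : #{i | c i ≠ 0 ∧ c' i ≠ 0} = hammingNorm c' :=
    congrArg card (filter_congr fun i _ => ⟨And.right, fun hi => ⟨h hi, hi⟩⟩)
  omega

theorem sum_mul_eq_zero_of_doublyEven {c c' : ι → ZMod 2} (h : 4 ∣ hammingNorm c)
    (h' : 4 ∣ hammingNorm c') (hadd : 4 ∣ hammingNorm (c + c')) : ∑ i, c i * c' i = 0 := by
  have h1 := hammingNorm_add_add_two_mul_card_inter c c'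
  rw [sum_mul_eq_card_inter, ZMod.natCast_eq_zero_iff]
  omega

theorem two_mul_card_affine_ne_zero [DecidableEq ι] (a : ZMod 2) {v : ι → ZMod 2} (hv : v ≠ 0) :
    2 * #{r : ι → ZMod 2 | a + v ⬝ᵥ r ≠ 0} = 2 ^ Fintype.card ι := by
  obtain ⟨j, hj⟩ := Function.ne_iff.mp hv
  have hflip (r : ι → ZMod 2) :
      a + v ⬝ᵥ (r + Pi.single j 1) ≠ 0 ↔ ¬ a + v ⬝ᵥ r ≠ 0 := by
    have key : ∀ x y z : ZMod 2, z ≠ 0 → (x + (y + z) ≠ 0 ↔ ¬ x + y ≠ 0) := by decide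
    rw [dotProduct_add, dotProduct_single, mul_one]
    exact key _ _ _ hj
  have hcard : #{r : ι → ZMod 2 | a + v ⬝ᵥ r ≠ 0} = #{r : ι → ZMod 2 | ¬ a + v ⬝ᵥ r ≠ 0} :=
    card_equiv (Equiv.addRight (Pi.single j 1)) fun r => by
      have := hflip r
      simp only [mem_filter, mem_univ, true_and, Equiv.coe_addRight]
      tauto
  have htot := card_filter_add_card_filter_not (s := (univ : Finset (ι → ZMod 2)))
    (fun r => a + v ⬝ᵥ r ≠ 0)
  rw [← hcard, card_univ, Fintype.card_fun, ZMod.card] at htot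
  omega

end BinaryWeights

namespace MinimalCode

/-- Messages of the base code. -/
abbrev BaseMsg := ZMod 2 × ZMod 2 × ZMod 2 × ZMod 2 × ZMod 2

/-- Coordinates of the base code. -/
abbrev BaseIdx := (ZMod 2 × ZMod 2 × ZMod 2) ⊕ (ZMod 2 × ZMod 2 × ZMod 2 × ZMod 2)

/-- The base `[24, 5]` code with weights 8, 12, 16. Its columns are the eight points
`(0, 1, w₁, w₂, w₃)` together with the sixteen points `(p, q, w₁, w₂, w₃)`, `w₃ = w₁w₂`. -/
def baseEnc : BaseMsg →ₗ[ZMod 2] (BaseIdx → ZMod 2) where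
  toFun y
    | .inl w => y.2.1 + (y.2.2.1 * w.1 + y.2.2.2.1 * w.2.1 + y.2.2.2.2 * w.2.2)
    | .inr w => y.1 * w.1 + y.2.1 * w.2.1 +
        (y.2.2.1 * w.2.2.1 + y.2.2.2.1 * w.2.2.2 + y.2.2.2.2 * (w.2.2.1 * w.2.2.2))
  map_add' x y := by
    funext i
    rcases i with w | w <;> simp only [Prod.fst_add, Prod.snd_add, Pi.add_apply] <;> ring
  map_smul' a y := by
    funext i
    rcases i with w | w <;>
      simp only [Prod.smul_fst, Prod.smul_snd, Pi.smul_apply, smul_eq_mul, RingHom.id_apply] <;>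
      ring

/-- The base coordinate at which every base codeword vanishes. -/
def baseZero : BaseIdx := .inr 0

theorem baseEnc_baseZero (y : BaseMsg) : baseEnc y baseZero = 0 := by
  simp [baseEnc, baseZero]

theorem hammingNorm_baseEnc (y : BaseMsg) : y = 0 ∨ hammingNorm (baseEnc y) = 8 ∨
    hammingNorm (baseEnc y) = 12 ∨ hammingNorm (baseEnc y) = 16 := by
  revert y; decide +kernel

theorem hammingNorm_baseEnc_add_ne : ∀ y, hammingNorm (baseEnc y) = 16 →
    ∀ y', hammingNorm (baseEnc y') = 8 → hammingNorm (baseEnc (y + y')) ≠ 8 := by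
  decide +kernel

variable {t : ℕ}

/-- Messages of the extended code. -/
abbrev Msg (t : ℕ) := BaseMsg × (Fin (2 * t) → ZMod 2)

/-- Coordinates of the extended code, including an identically zero one. -/
abbrev Idx (t : ℕ) := BaseIdx × (Fin (2 * t) → ZMod 2)

/-- The sum of the base code and the simplex code. -/
def enc (t : ℕ) : Msg t →ₗ[ZMod 2] (Idx t → ZMod 2) where
  toFun x p := baseEnc x.1 p.1 + x.2 ⬝ᵥ p.2
  map_add' x y := by
    funext p
    simp only [Prod.fst_add, Prod.snd_add, map_add, Pi.add_apply, add_dotProduct]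
    ring
  map_smul' a x := by
    funext p
    simp [smul_dotProduct, mul_add]

theorem enc_zero_coord (x : Msg t) : enc t x (baseZero, 0) = 0 := by
  simp [enc, baseEnc_baseZero]

theorem hammingNorm_enc (x : Msg t) : hammingNorm (enc t x) =
    ∑ i, #{r : Fin (2 * t) → ZMod 2 | baseEnc x.1 i + x.2 ⬝ᵥ r ≠ 0} := by
  simp only [hammingNorm, card_filter, Fintype.sum_prod_type]
  rfl

theorem hammingNorm_enc_of_snd_eq_zero (y : BaseMsg) :
    hammingNorm (enc t (y, 0)) = hammingNorm (baseEnc y) * 2 ^ (2 * t) := by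
  rw [hammingNorm_enc, hammingNorm, card_filter, sum_mul]
  refine sum_congr rfl fun i _ => ?_
  by_cases h : baseEnc y i = 0 <;> simp [h]

theorem hammingNorm_enc_of_snd_ne_zero {x : Msg t} (hx : x.2 ≠ 0) :
    hammingNorm (enc t x) = 12 * 2 ^ (2 * t) := by
  have h : 2 * hammingNorm (enc t x) = 24 * 2 ^ (2 * t) := by
    rw [hammingNorm_enc, mul_sum]
    simp only [two_mul_card_affine_ne_zero _ hx, Fintype.card_fin]
    simp [ZMod.card]
  omega

theorem hammingNorm_enc_cases {x : Msg t} (hx : x ≠ 0) :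
    hammingNorm (enc t x) = 8 * 2 ^ (2 * t) ∨ hammingNorm (enc t x) = 12 * 2 ^ (2 * t) ∨
      hammingNorm (enc t x) = 16 * 2 ^ (2 * t) := by
  obtain ⟨y, v⟩ := x
  by_cases hv : v = 0
  · subst hv
    rw [hammingNorm_enc_of_snd_eq_zero]
    rcases hammingNorm_baseEnc y with h | h | h | h
    · simp [h] at hx
    all_goals simp [h]
  · exact Or.inr (Or.inl (hammingNorm_enc_of_snd_ne_zero hv))

theorem hammingNorm_enc_add_ne {x x' : Msg t} (h : hammingNorm (enc t x) = 16 * 2 ^ (2 * t))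
    (h' : hammingNorm (enc t x') = 8 * 2 ^ (2 * t)) :
    hammingNorm (enc t (x + x')) ≠ 8 * 2 ^ (2 * t) := by
  obtain ⟨y, v⟩ := x
  obtain ⟨y', v'⟩ := x'
  have hpos : 0 < 2 ^ (2 * t) := by positivity
  have hv : v = 0 := by
    by_contra hv
    rw [hammingNorm_enc_of_snd_ne_zero hv] at h
    omega
  have hv' : v' = 0 := by
    by_contra hv'
    rw [hammingNorm_enc_of_snd_ne_zero hv'] at h'
    omega
  subst hv hv'
  rw [hammingNorm_enc_of_snd_eq_zero] at h h'
  rw [Prod.mk_add_mk, add_zero, hammingNorm_enc_of_snd_eq_zero]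
  exact fun h'' => hammingNorm_baseEnc_add_ne y (Nat.eq_of_mul_eq_mul_right hpos h) y'
    (Nat.eq_of_mul_eq_mul_right hpos h') (Nat.eq_of_mul_eq_mul_right hpos h'')

/-- Any length-`n` enumeration of the coordinates other than the identically zero one yields a
code with the weights of `enc`. -/
def puncturedEnc {n : ℕ} (e : Fin n ≃ {p : Idx t // p ≠ (baseZero, 0)}) :
    Msg t →ₗ[ZMod 2] (Fin n → ZMod 2) :=
  LinearMap.funLeft (ZMod 2) (ZMod 2) (fun j => (e j).1) ∘ₗ enc t

variable {n : ℕ} (e : Fin n ≃ {p : Idx t // p ≠ (baseZero, 0)})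

theorem hammingNorm_puncturedEnc (x : Msg t) :
    hammingNorm (puncturedEnc e x) = hammingNorm (enc t x) := by
  refine card_bij (fun j _ => (e j).1) (fun j hj => ?_) (fun j _ k _ h => ?_) (fun p hp => ?_)
  · rw [mem_filter_univ] at hj ⊢
    exact hj
  · exact e.injective (Subtype.ext h)
  · have hp' : enc t x p ≠ 0 := (mem_filter.mp hp).2
    have hne : p ≠ (baseZero, 0) := fun h => hp' (h ▸ enc_zero_coord x)
    exact ⟨e.symm ⟨p, hne⟩, mem_filter.mpr ⟨mem_univ _, by simpa [puncturedEnc] using hp'⟩, by simp⟩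

theorem hammingNorm_puncturedEnc_cases {x : Msg t} (hx : x ≠ 0) :
    hammingNorm (puncturedEnc e x) = 8 * 2 ^ (2 * t) ∨
      hammingNorm (puncturedEnc e x) = 12 * 2 ^ (2 * t) ∨
      hammingNorm (puncturedEnc e x) = 16 * 2 ^ (2 * t) := by
  rw [hammingNorm_puncturedEnc]
  exact hammingNorm_enc_cases hx

theorem puncturedEnc_injective : Function.Injective (puncturedEnc e) := by
  rw [injective_iff_map_eq_zero]
  intro x hx
  by_contra hne
  have hpos : 0 < 2 ^ (2 * t) := by positivity
  have := hammingNorm_puncturedEnc_cases e hne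
  rw [hx, hammingNorm_zero] at this
  omega

theorem finrank_range_puncturedEnc :
    Module.finrank (ZMod 2) (LinearMap.range (puncturedEnc e)) = 2 * t + 5 := by
  rw [LinearMap.finrank_range_of_inj (puncturedEnc_injective e)]
  simp [Module.finrank_prod]
  omega

theorem exists_hammingNorm_puncturedEnc_min :
    ∃ x, x ≠ 0 ∧ hammingNorm (puncturedEnc e x) = 8 * 2 ^ (2 * t) := by
  refine ⟨((1, 0, 0, 0, 0), 0), by simp, ?_⟩
  rw [hammingNorm_puncturedEnc, hammingNorm_enc_of_snd_eq_zero]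
  congr 1

theorem exists_hammingNorm_puncturedEnc_max :
    ∃ x, hammingNorm (puncturedEnc e x) = 16 * 2 ^ (2 * t) := by
  refine ⟨((0, 1, 0, 0, 0), 0), ?_⟩
  rw [hammingNorm_puncturedEnc, hammingNorm_enc_of_snd_eq_zero]
  congr 1

theorem wmin_range_puncturedEnc :
    wmin (LinearMap.range (puncturedEnc e)) = 8 * 2 ^ (2 * t) := by
  refine IsLeast.csInf_eq ⟨?_, ?_⟩
  · obtain ⟨x, hx, hw⟩ := exists_hammingNorm_puncturedEnc_min e
    exact ⟨_, ⟨x, rfl⟩, fun h => hx (puncturedEnc_injective e (h.trans (map_zero _).symm)), hw⟩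
  · rintro _ ⟨_, ⟨x, rfl⟩, hx, rfl⟩
    have := hammingNorm_puncturedEnc_cases e (x := x) (by rintro rfl; simp at hx)
    omega

theorem wmax_range_puncturedEnc :
    wmax (LinearMap.range (puncturedEnc e)) = 16 * 2 ^ (2 * t) := by
  refine IsGreatest.csSup_eq ⟨?_, ?_⟩
  · obtain ⟨x, hw⟩ := exists_hammingNorm_puncturedEnc_max e
    exact ⟨_, ⟨x, rfl⟩, hw⟩
  · rintro _ ⟨_, ⟨x, rfl⟩, rfl⟩
    by_cases hx : x = 0
    · simp [hx]
    · have := hammingNorm_puncturedEnc_cases e hx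
      omega

theorem isMinimalCode_range_puncturedEnc :
    IsMinimalCode (LinearMap.range (puncturedEnc e)) := by
  rintro _ ⟨x, rfl⟩ hx _ ⟨x', rfl⟩ hsub
  by_cases hx' : x' = 0
  · exact ⟨0, by simp [hx']⟩
  by_cases hadd : x + x' = 0
  · refine ⟨1, ?_⟩
    have hz : puncturedEnc e x' + puncturedEnc e x = 0 := by
      rw [← map_add, add_comm, hadd, map_zero]
    rw [one_smul]
    exact funext fun i => CharTwo.add_eq_zero.mp (congrFun hz i)
  exfalso
  have hx0 : x ≠ 0 := by rintro rfl; simp at hx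
  have hpos : 0 < 2 ^ (2 * t) := by positivity
  have hw := hammingNorm_add_of_support_subset hsub
  rw [← map_add, hammingNorm_puncturedEnc, hammingNorm_puncturedEnc,
    hammingNorm_puncturedEnc] at hw
  have h1 := hammingNorm_enc_cases hx0
  have h2 := hammingNorm_enc_cases hx'
  have h3 := hammingNorm_enc_cases hadd
  exact hammingNorm_enc_add_ne (x := x) (x' := x') (by omega) (by omega) (by omega)

theorem selfOrthogonal_range_puncturedEnc :
    SelfOrthogonal (LinearMap.range (puncturedEnc e)) := by
  have h4 (x : Msg t) : 4 ∣ hammingNorm (puncturedEnc e x) := by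
    by_cases hx : x = 0
    · simp [hx]
    · have := hammingNorm_puncturedEnc_cases e hx
      omega
  rintro _ ⟨x, rfl⟩ _ ⟨x', rfl⟩
  exact sum_mul_eq_zero_of_doublyEven (h4 x) (h4 x') (by rw [← map_add]; exact h4 _)

theorem card_puncturedIdx (t : ℕ) :
    Fintype.card {p : Idx t // p ≠ (baseZero, 0)} = 24 * 2 ^ (2 * t) - 1 := by
  simp [Fintype.card_subtype_compl, ZMod.card]

end MinimalCode

/-- Proposition 5.2. -/
theorem minimal_code_violating_AB_Hu2021
    {m : ℕ} (hm : 3 ≤ m) :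
    ∃ C : Submodule (ZMod 2) (Fin (3 * 2 ^ (2 * m - 3) - 1) → ZMod 2),
      Module.finrank (ZMod 2) C = 2 * m - 1 ∧
      wmin C = 2 ^ (2 * m - 3) ∧
      wmax C = 2 ^ (2 * m - 2) ∧
      IsMinimalCode C ∧
      2 * wmin C ≤ (2 - 1) * wmax C ∧
      (4 ≤ m → SelfOrthogonal C) := by
  obtain ⟨t, rfl⟩ : ∃ t, m = t + 3 := ⟨m - 3, by omega⟩
  have h3 : 2 ^ (2 * (t + 3) - 3) = 8 * 2 ^ (2 * t) := by
    rw [show 2 * (t + 3) - 3 = 3 + 2 * t by omega, pow_add]; rfl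
  have h2 : 2 ^ (2 * (t + 3) - 2) = 16 * 2 ^ (2 * t) := by
    rw [show 2 * (t + 3) - 2 = 4 + 2 * t by omega, pow_add]; rfl
  have hcard : Fintype.card {p : MinimalCode.Idx t // p ≠ (MinimalCode.baseZero, 0)} =
      3 * 2 ^ (2 * (t + 3) - 3) - 1 := by
    rw [MinimalCode.card_puncturedIdx, h3]
    omega
  let e := (Fintype.equivFinOfCardEq hcard).symm
  refine ⟨LinearMap.range (MinimalCode.puncturedEnc e), ?_, ?_, ?_,
    MinimalCode.isMinimalCode_range_puncturedEnc e, ?_,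
    fun _ => MinimalCode.selfOrthogonal_range_puncturedEnc e⟩
  · rw [MinimalCode.finrank_range_puncturedEnc]
    omega
  · rw [MinimalCode.wmin_range_puncturedEnc, h3]
  · rw [MinimalCode.wmax_range_puncturedEnc, h2]
  · rw [MinimalCode.wmin_range_puncturedEnc, MinimalCode.wmax_range_puncturedEnc]
    omega
end

section
/- Let m ≥ 3 be an integer. Then there exists a binary linear code (q = 2) with parameters [3·2^{2m−4} − 1, 2m−2, 2^{2m−4}]_2 and maximum weight 2^{2m−3} that is a minimal code violating the Ashikhmin-Barg condition. Moreover, when m ≥ 4, such a code can be taken to be self-orthogonal. -/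
open Finset BigOperators

/-- Generator matrix (transposed) of a minimal `[11, 4, 4]` binary code of maximum weight `8`,
preceded by a zero row. -/
def baseMatrix : Matrix (Fin 12) (Fin 4) (ZMod 2) :=
  !![0, 0, 0, 0; 1, 0, 0, 0; 1, 0, 0, 0; 1, 0, 0, 0; 0, 1, 0, 0; 1, 1, 0, 0;
     0, 0, 1, 0; 1, 0, 1, 0; 0, 0, 0, 1; 0, 1, 0, 1; 0, 0, 1, 1; 1, 1, 1, 1]

lemma baseMatrix_mulVec_zero (u : Fin 4 → ZMod 2) : (baseMatrix.mulVec u) 0 = 0 := by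
  revert u; decide +kernel

lemma hammingNorm_baseMatrix_mulVec (u : Fin 4 → ZMod 2) (hu : u ≠ 0) :
    4 ≤ hammingNorm (baseMatrix.mulVec u) ∧ hammingNorm (baseMatrix.mulVec u) ≤ 8 := by
  revert u; decide +kernel

lemma exists_baseMatrix_mulVec_eq_zero_one (u v : Fin 4 → ZMod 2) (hv : v ≠ 0) (huv : v ≠ u) :
    ∃ g, baseMatrix.mulVec u g = 0 ∧ baseMatrix.mulVec v g = 1 := by
  revert u v; decide +kernel

/-- The coordinate functional `(g, y) ↦ (B u)_g + w ⬝ y` attached to a message `(u, w)`. -/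
def extendedMap (r : ℕ) : ((Fin 4 → ZMod 2) × (Fin r → ZMod 2)) →ₗ[ZMod 2]
    (Fin 12 × (Fin r → ZMod 2) → ZMod 2) where
  toFun x p := baseMatrix.mulVec x.1 p.1 + x.2 ⬝ᵥ p.2
  map_add' x y := by
    ext p
    simp only [Prod.fst_add, Prod.snd_add, Matrix.mulVec_add, add_dotProduct, Pi.add_apply]
    ring
  map_smul' c x := by
    ext p
    simp [Matrix.mulVec_smul, mul_add]

lemma extendedMap_apply {r : ℕ} (x : (Fin 4 → ZMod 2) × (Fin r → ZMod 2))
    (p : Fin 12 × (Fin r → ZMod 2)) :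
    extendedMap r x p = baseMatrix.mulVec x.1 p.1 + x.2 ⬝ᵥ p.2 := rfl

lemma extendedMap_apply_zero {r : ℕ} (x : (Fin 4 → ZMod 2) × (Fin r → ZMod 2)) :
    extendedMap r x 0 = 0 := by
  simp [extendedMap_apply, baseMatrix_mulVec_zero]

lemma ZMod.eq_zero_or_one (a : ZMod 2) : a = 0 ∨ a = 1 := by
  revert a; decide

lemma exists_dotProduct_eq_one {r : ℕ} {w : Fin r → ZMod 2} (hw : w ≠ 0) :
    ∃ y, w ⬝ᵥ y = 1 := by
  obtain ⟨i, hi⟩ := Function.ne_iff.mp hw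
  exact ⟨Pi.single i 1, by simpa using (ZMod.eq_zero_or_one (w i)).resolve_left hi⟩

lemma exists_dotProduct_eq_zero_one {r : ℕ} {w v : Fin r → ZMod 2} (hv : v ≠ 0) (hvw : v ≠ w) :
    ∃ y, w ⬝ᵥ y = 0 ∧ v ⬝ᵥ y = 1 := by
  by_contra! h
  obtain ⟨a, ha⟩ := exists_dotProduct_eq_one hv
  obtain ⟨b, hb⟩ := exists_dotProduct_eq_one (sub_ne_zero.mpr hvw)
  have key (y : Fin r → ZMod 2) : w ⬝ᵥ y = 1 ∨ v ⬝ᵥ y = 0 := by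
    rcases ZMod.eq_zero_or_one (w ⬝ᵥ y) with h0 | h1
    · exact .inr ((ZMod.eq_zero_or_one _).resolve_right (h y h0))
    · exact .inl h1
  have ka := key a
  have kb := key b
  have kab := key (a + b)
  rw [sub_dotProduct] at hb
  simp only [dotProduct_add] at kab
  generalize w ⬝ᵥ a = p at *
  generalize v ⬝ᵥ a = q at *
  generalize w ⬝ᵥ b = s at *
  generalize v ⬝ᵥ b = t at *
  clear key h
  revert p q s t
  decide

lemma exists_extendedMap_eq_zero_one {r : ℕ} {x x' : (Fin 4 → ZMod 2) × (Fin r → ZMod 2)}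
    (hx' : x' ≠ 0) (hne : x' ≠ x) :
    ∃ p, extendedMap r x p = 0 ∧ extendedMap r x' p = 1 := by
  obtain ⟨u, w⟩ := x
  obtain ⟨v, z⟩ := x'
  simp only [extendedMap_apply, Prod.exists]
  by_cases hz : z = 0
  · subst hz
    have hv : v ≠ 0 := by rintro rfl; exact hx' rfl
    by_cases hw : w = 0
    · subst hw
      obtain ⟨g, h0, h1⟩ := exists_baseMatrix_mulVec_eq_zero_one u v hv (by rintro rfl; exact hne rfl)
      exact ⟨g, 0, by simp [h0, h1]⟩
    · obtain ⟨y, hy⟩ := exists_dotProduct_eq_one hw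
      obtain ⟨g, -, h1⟩ := exists_baseMatrix_mulVec_eq_zero_one 0 v hv hv
      exact ⟨g, baseMatrix.mulVec u g • y, by
        simp [h1, hy, CharTwo.add_self_eq_zero]⟩
  · by_cases hzw : z = w
    · subst hzw
      have huv : v - u ≠ 0 := sub_ne_zero.mpr (by rintro rfl; exact hne rfl)
      obtain ⟨y, hy⟩ := exists_dotProduct_eq_one hz
      obtain ⟨g, -, h1⟩ := exists_baseMatrix_mulVec_eq_zero_one 0 (v - u) huv huv
      refine ⟨g, baseMatrix.mulVec u g • y, ?_⟩
      rw [Matrix.mulVec_sub, Pi.sub_apply, CharTwo.sub_eq_add] at h1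
      simp [hy, CharTwo.add_self_eq_zero, h1]
    · obtain ⟨y, h0, h1⟩ := exists_dotProduct_eq_zero_one hz hzw
      exact ⟨0, y, by simp [baseMatrix_mulVec_zero, h0, h1]⟩

lemma hammingNorm_extendedMap_of_snd_eq_zero {r : ℕ} (u : Fin 4 → ZMod 2) :
    hammingNorm (extendedMap r (u, 0)) = hammingNorm (baseMatrix.mulVec u) * 2 ^ r := by
  have : (univ.filter fun p : Fin 12 × (Fin r → ZMod 2) => extendedMap r (u, 0) p ≠ 0) =
      (univ.filter fun g => baseMatrix.mulVec u g ≠ 0) ×ˢ univ := by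
    ext p; simp [extendedMap_apply]
  rw [hammingNorm, this, card_product]
  simp [hammingNorm, ZMod.card]

lemma hammingNorm_extendedMap_of_snd_ne_zero {r : ℕ} (u : Fin 4 → ZMod 2) {w : Fin r → ZMod 2}
    (hw : w ≠ 0) : hammingNorm (extendedMap r (u, w)) = 6 * 2 ^ r := by
  obtain ⟨y, hy⟩ := exists_dotProduct_eq_one hw
  have hflip (p) : extendedMap r (u, w) (p + (0, y)) = extendedMap r (u, w) p + 1 := by
    simp [extendedMap_apply, dotProduct_add, hy, add_assoc]
  have hcard : (univ.filter fun p => extendedMap r (u, w) p ≠ 0).card =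
      (univ.filter fun p => ¬ extendedMap r (u, w) p ≠ 0).card := by
    refine card_equiv (Equiv.addRight (0, y)) fun p => ?_
    simp only [mem_filter, mem_univ, true_and, Equiv.coe_addRight, hflip]
    generalize extendedMap r (u, w) p = a
    revert a; decide
  have htot := card_filter_add_card_filter_not (s := univ)
    (fun p => extendedMap r (u, w) p ≠ 0)
  rw [← hcard] at htot
  simp only [card_univ, Fintype.card_prod, Fintype.card_fin, Fintype.card_fun, ZMod.card] at htot
  rw [hammingNorm]
  omega

lemma hammingNorm_comp_subtype {ι κ R : Type*} [Fintype ι] [Fintype κ] [Zero R] [DecidableEq R]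
    {c : κ → R} {k : κ} (hk : c k = 0) (e : ι ≃ {p // p ≠ k}) :
    hammingNorm (fun i => c (e i)) = hammingNorm c := by
  refine card_bij (fun i _ => (e i : κ)) (by simp) (by simp [Subtype.val_inj]) fun p hp => ?_
  have hpk : p ≠ k := by rintro rfl; simp [hk] at hp
  exact ⟨e.symm ⟨p, hpk⟩, by simpa using hp, by simp⟩

/-- A doubly-even binary linear code is self-orthogonal. -/
lemma selfOrthogonal_of_four_dvd {n : ℕ} {C : Submodule (ZMod 2) (Fin n → ZMod 2)}
    (h : ∀ c ∈ C, 4 ∣ hammingNorm c) : SelfOrthogonal C := by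
  intro c hc c' hc'
  have hpt : ∀ a b : ZMod 2, (if a + b ≠ 0 then 1 else 0) + 2 * (if a * b ≠ 0 then 1 else 0) =
      (if a ≠ 0 then 1 else 0) + if b ≠ 0 then 1 else 0 := by decide
  have hsum : hammingNorm (c + c') + 2 * hammingNorm (c * c') =
      hammingNorm c + hammingNorm c' := by
    simp only [hammingNorm, card_filter, mul_sum, ← sum_add_distrib, Pi.add_apply, Pi.mul_apply]
    exact sum_congr rfl fun i _ => hpt _ _
  have hval : ∑ i, c i * c' i = (hammingNorm (c * c') : ZMod 2) := by
    rw [hammingNorm, card_filter, Nat.cast_sum]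
    refine sum_congr rfl fun i _ => ?_
    rw [Pi.mul_apply]
    generalize c i * c' i = a
    revert a; decide
  rw [hval, ZMod.natCast_eq_zero_iff]
  have h₁ := h _ hc
  have h₂ := h _ hc'
  have h₃ := h _ (C.add_mem hc hc')
  omega

lemma wmin_eq_of_forall_le {F : Type} [Field F] [Fintype F] [DecidableEq F] {n w : ℕ}
    {C : Submodule F (Fin n → F)} (hle : ∀ c ∈ C, c ≠ 0 → w ≤ hammingNorm c)
    (hex : ∃ c ∈ C, c ≠ 0 ∧ hammingNorm c = w) : wmin C = w :=
  IsLeast.csInf_eq ⟨hex, by rintro _ ⟨c, hc, h0, rfl⟩; exact hle c hc h0⟩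

lemma wmax_eq_of_forall_le {F : Type} [Field F] [Fintype F] [DecidableEq F] {n w : ℕ}
    {C : Submodule F (Fin n → F)} (hle : ∀ c ∈ C, hammingNorm c ≤ w)
    (hex : ∃ c ∈ C, hammingNorm c = w) : wmax C = w :=
  IsGreatest.csSup_eq ⟨hex, by rintro _ ⟨c, hc, rfl⟩; exact hle c hc⟩

/-- Proposition 5.4. -/
theorem minimal_code_violating_AB_WZZ
    {m : ℕ} (hm : 3 ≤ m) :
    ∃ C : Submodule (ZMod 2) (Fin (3 * 2 ^ (2 * m - 4) - 1) → ZMod 2),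
      Module.finrank (ZMod 2) C = 2 * m - 2 ∧
      wmin C = 2 ^ (2 * m - 4) ∧
      wmax C = 2 ^ (2 * m - 3) ∧
      IsMinimalCode C ∧
      2 * wmin C ≤ (2 - 1) * wmax C ∧
      (4 ≤ m → SelfOrthogonal C) := by
  obtain ⟨s, rfl⟩ := Nat.exists_eq_add_of_le hm
  obtain ⟨r, hr⟩ : ∃ r, r = 2 * s := ⟨_, rfl⟩
  have h4 : 2 ^ (2 * (3 + s) - 4) = 4 * 2 ^ r := by
    rw [show 2 * (3 + s) - 4 = r + 2 by omega, pow_add]; ring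
  have h3 : 2 ^ (2 * (3 + s) - 3) = 8 * 2 ^ r := by
    rw [show 2 * (3 + s) - 3 = r + 3 by omega, pow_add]; ring
  have hpos : 0 < 2 ^ r := by positivity
  have hcard : Fintype.card (Fin (3 * 2 ^ (2 * (3 + s) - 4) - 1)) =
      Fintype.card {p : Fin 12 × (Fin r → ZMod 2) // p ≠ 0} := by
    rw [Fintype.card_subtype_compl, Fintype.card_subtype_eq]
    simp only [Fintype.card_prod, Fintype.card_fin, Fintype.card_fun, ZMod.card]
    omega
  let e := Fintype.equivOfCardEq hcard
  let φ := (LinearMap.funLeft (ZMod 2) (ZMod 2) fun i => (e i).1) ∘ₗ extendedMap r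
  have hφ (x i) : φ x i = extendedMap r x (e i).1 := rfl
  have hnorm (x) : hammingNorm (φ x) = hammingNorm (extendedMap r x) :=
    hammingNorm_comp_subtype (extendedMap_apply_zero x) e
  have hsep {x x'} (hx' : x' ≠ 0) (hne : x' ≠ x) : ∃ i, φ x i = 0 ∧ φ x' i = 1 := by
    obtain ⟨p, h0, h1⟩ := exists_extendedMap_eq_zero_one hx' hne
    have hp : p ≠ 0 := by rintro rfl; simp [extendedMap_apply_zero] at h1
    exact ⟨e.symm ⟨p, hp⟩, by simpa [hφ] using h0, by simpa [hφ] using h1⟩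
  have hinj : Function.Injective φ := by
    rw [← LinearMap.ker_eq_bot, LinearMap.ker_eq_bot']
    intro x hx
    by_contra hne
    obtain ⟨i, -, hi⟩ := hsep hne hne
    simp [hx] at hi
  have hbounds (x) (hx : x ≠ 0) :
      4 * 2 ^ r ≤ hammingNorm (φ x) ∧ hammingNorm (φ x) ≤ 8 * 2 ^ r := by
    rw [hnorm]
    obtain ⟨u, w⟩ := x
    by_cases hw : w = 0
    · subst hw
      obtain ⟨hl, hu⟩ := hammingNorm_baseMatrix_mulVec u (by rintro rfl; exact hx rfl)
      rw [hammingNorm_extendedMap_of_snd_eq_zero]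
      exact ⟨Nat.mul_le_mul_right _ hl, Nat.mul_le_mul_right _ hu⟩
    · rw [hammingNorm_extendedMap_of_snd_ne_zero u hw]
      omega
  have hmin : wmin (LinearMap.range φ) = 4 * 2 ^ r := by
    refine wmin_eq_of_forall_le ?_ ⟨φ (![0, 1, 0, 0], 0), ⟨_, rfl⟩, ?_, ?_⟩
    · rintro _ ⟨x, rfl⟩ hx
      exact (hbounds x (by rintro rfl; simp at hx)).1
    · rw [ne_eq, map_eq_zero_iff φ hinj, Prod.mk_eq_zero]
      exact fun h => absurd h.1 (by decide)
    · rw [hnorm, hammingNorm_extendedMap_of_snd_eq_zero]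
      congr 1
  have hmax : wmax (LinearMap.range φ) = 8 * 2 ^ r := by
    refine wmax_eq_of_forall_le ?_ ⟨φ (![1, 1, 1, 0], 0), ⟨_, rfl⟩, ?_⟩
    · rintro _ ⟨x, rfl⟩
      by_cases hx : x = 0
      · simp [hx]
      · exact (hbounds x hx).2
    · rw [hnorm, hammingNorm_extendedMap_of_snd_eq_zero]
      congr 1
  refine ⟨LinearMap.range φ, ?_, by rw [hmin, h4], by rw [hmax, h3], ?_, by omega, fun hm4 => ?_⟩
  · rw [LinearMap.finrank_range_of_inj hinj]
    simp only [Module.finrank_prod, Module.finrank_fin_fun]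
    omega
  · rintro _ ⟨x, rfl⟩ - _ ⟨x', rfl⟩ hsub
    by_cases hx' : x' = 0
    · exact ⟨0, by simp [hx']⟩
    by_cases hne : x' = x
    · exact ⟨1, by simp [hne]⟩
    obtain ⟨i, h0, h1⟩ := hsep hx' hne
    exact absurd h0 (hsub (by simp [h1]))
  · have h2 : 4 ∣ 2 ^ r := pow_dvd_pow 2 (show 2 ≤ r by omega)
    refine selfOrthogonal_of_four_dvd ?_
    rintro _ ⟨⟨u, w⟩, rfl⟩
    rw [hnorm]
    by_cases hw : w = 0
    · subst hw
      rw [hammingNorm_extendedMap_of_snd_eq_zero]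
      exact h2.mul_left _
    · rw [hammingNorm_extendedMap_of_snd_ne_zero u hw]
      exact h2.mul_left _
end
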